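/- arXiv:1605.00001 — 2 statements merged into one kernel-verified Lean document; each statement's English description precedes it below -/
import Mathlib

section
/- Joint generating function (Eq. (3.13)): for every real λ with 0 < λ < 1, every real V with 0 ≤ V ≤ 1, every integer Z ≥ 1 and every integer X, the double series ∑_{N=0}^∞ ∑_{K=0}^N λ^N V^K P_N(X, K | Z) converges and equals ((1+α²)/(1−α²)) (α^{|X|} − α^Z α^{|X−Z|}) + ((1+α²)/(1+α² − 2α²V)) V α^Z α^{|X−Z|}, where α = (1 − √(1−λ²))/λ. -/
open Finset Filter Real

noncomputable section

/-- A walk path of length `N` is `ε : Fin N → Bool`; `true` means a `+1` step,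
`false` a `-1` step. `S ε n` is the partial sum `S_n` of the first `n` steps. -/
def S {N : ℕ} (ε : Fin N → Bool) (n : ℕ) : ℤ :=
  ∑ i ∈ Finset.univ.filter (fun i : Fin N => (i : ℕ) < n), (if ε i then (1 : ℤ) else -1)

/-- `p N X`: probability the simple symmetric random walk is at `X` after `N` steps. -/
def p (N : ℕ) (X : ℤ) : ℝ :=
  ((Finset.univ.filter (fun ε : Fin N → Bool => S ε N = X)).card : ℝ) / 2 ^ N

/-- Number of visits of the path `ε` to site `Z` at times `n ∈ {1, …, N}`. -/
def visits (N : ℕ) (Z : ℤ) (ε : Fin N → Bool) : ℕ :=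
  ((Finset.Icc 1 N).filter (fun n => S ε n = Z)).card

/-- `P N X K Z`: joint probability that after `N` steps the walk is at `X`
and has visited `Z` exactly `K` times. -/
def P (N : ℕ) (X : ℤ) (K : ℕ) (Z : ℤ) : ℝ :=
  ((Finset.univ.filter
      (fun ε : Fin N → Bool => S ε N = X ∧ visits N Z ε = K)).card : ℝ) / 2 ^ N

/-- `Pmarg N K Z`: probability of exactly `K` visits to `Z` in the first `N` steps. -/
def Pmarg (N : ℕ) (K : ℕ) (Z : ℤ) : ℝ :=
  ((Finset.univ.filter (fun ε : Fin N → Bool => visits N Z ε = K)).card : ℝ) / 2 ^ N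

theorem S_snoc_of_le {N : ℕ} (ε : Fin N → Bool) (b : Bool) {n : ℕ} (hn : n ≤ N) :
    S (Fin.snoc ε b : Fin (N + 1) → Bool) n = S ε n := by
  simp only [S, Finset.sum_filter, Fin.sum_univ_castSucc, Fin.snoc_castSucc, Fin.snoc_last,
    Fin.val_castSucc, Fin.val_last]
  simp [hn.not_gt]

theorem S_snoc_succ {N : ℕ} (ε : Fin N → Bool) (b : Bool) :
    S (Fin.snoc ε b : Fin (N + 1) → Bool) (N + 1) = S ε N + if b then 1 else -1 := by
  simp only [S, Finset.sum_filter, Fin.sum_univ_castSucc, Fin.snoc_castSucc, Fin.snoc_last,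
    Fin.val_castSucc, Fin.val_last]
  congr 1
  · refine Finset.sum_congr rfl fun i _ => ?_
    rw [if_pos (by omega), if_pos i.2]
  · simp

theorem visits_le (N : ℕ) (Z : ℤ) (ε : Fin N → Bool) : visits N Z ε ≤ N := by
  simpa [visits] using Finset.card_filter_le (Finset.Icc 1 N) (fun n => S ε n = Z)

theorem visits_snoc {N : ℕ} (Z : ℤ) (ε : Fin N → Bool) (b : Bool) :
    visits (N + 1) Z (Fin.snoc ε b : Fin (N + 1) → Bool) =
      visits N Z ε + if (S ε N + if b then 1 else -1) = Z then 1 else 0 := by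
  simp only [visits, Finset.card_filter]
  rw [Finset.sum_Icc_succ_top (by omega), S_snoc_succ]
  congr 1
  refine Finset.sum_congr rfl fun n hn => ?_
  rw [S_snoc_of_le ε b (Finset.mem_Icc.mp hn).2]

/-- The expectation of `V ^ visits` restricted to the walks that end at `X`. -/
def visitMoment (V : ℝ) (Z : ℤ) (N : ℕ) (X : ℤ) : ℝ :=
  (∑ ε : Fin N → Bool, if S ε N = X then V ^ visits N Z ε else 0) / 2 ^ N

theorem sum_pow_mul_P (V : ℝ) (Z : ℤ) (N : ℕ) (X : ℤ) :
    ∑ K ∈ Finset.range (N + 1), V ^ K * P N X K Z = visitMoment V Z N X := by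
  simp only [P, visitMoment, Finset.card_filter, mul_div_assoc', ← Finset.sum_div, Nat.cast_sum,
    Finset.mul_sum]
  rw [Finset.sum_comm]
  congr 1
  refine Finset.sum_congr rfl fun ε _ => ?_
  by_cases h : S ε N = X <;> simp [h, Nat.lt_succ_of_le (visits_le N Z ε)]

theorem visitMoment_nonneg {V : ℝ} (hV : 0 ≤ V) (Z : ℤ) (N : ℕ) (X : ℤ) :
    0 ≤ visitMoment V Z N X := by
  unfold visitMoment
  positivity

theorem visitMoment_zero (V : ℝ) (Z X : ℤ) :
    visitMoment V Z 0 X = if X = 0 then 1 else 0 := by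
  simp [visitMoment, S, visits, eq_comm (a := (0 : ℤ)) (b := X)]

theorem visitMoment_succ (V : ℝ) (Z : ℤ) (N : ℕ) (X : ℤ) :
    visitMoment V Z (N + 1) X = (if X = Z then V else 1) *
      ((visitMoment V Z N (X - 1) + visitMoment V Z N (X + 1)) / 2) := by
  have hterm : ∀ (ε : Fin N → Bool) (d : ℤ),
      (if S ε N + d = X then V ^ (visits N Z ε + if S ε N + d = Z then 1 else 0) else 0) =
        (if X = Z then V else 1) * if S ε N = X - d then V ^ visits N Z ε else 0 := by
    intro ε d
    by_cases h : S ε N + d = X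
    · rw [if_pos h, if_pos (eq_sub_of_add_eq h), h]
      split_ifs <;> ring
    · rw [if_neg h, if_neg (mt add_eq_of_eq_sub h), mul_zero]
  have hsnoc : ∀ (b : Bool) (ε : Fin N → Bool),
      (Fin.snocEquiv fun _ : Fin (N + 1) => Bool) (b, ε) =
        (Fin.snoc ε b : Fin (N + 1) → Bool) := fun _ _ => rfl
  simp only [visitMoment]
  rw [← (Fin.snocEquiv fun _ : Fin (N + 1) => Bool).sum_comp, Fintype.sum_prod_type]
  simp only [hsnoc, S_snoc_succ, visits_snoc, hterm, Fintype.sum_bool,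
    ← Finset.mul_sum, if_true, Bool.false_eq_true, if_false, sub_neg_eq_add]
  field_simp
  ring

/-- A bounded solution of the one-step equation for the generating function is its sum. -/
theorem hasSum_of_bounded_solution {l V : ℝ} (hl0 : 0 ≤ l) (hl1 : l < 1) (hV0 : 0 ≤ V)
    (hV1 : V ≤ 1) (Z : ℤ) (F : ℤ → ℝ) (C : ℝ) (hC : ∀ X, |F X| ≤ C)
    (hF : ∀ X, F X = (if X = 0 then 1 else 0) +
      (if X = Z then V else 1) * (l * ((F (X - 1) + F (X + 1)) / 2))) (X : ℤ) :
    HasSum (fun N : ℕ => l ^ N * visitMoment V Z N X) (F X) := by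
  set s : ℕ → ℤ → ℝ := fun n X => ∑ N ∈ Finset.range n, l ^ N * visitMoment V Z N X with hs
  have hstep : ∀ n X, s (n + 1) X = (if X = 0 then 1 else 0) +
      (if X = Z then V else 1) * (l * ((s n (X - 1) + s n (X + 1)) / 2)) := by
    intro n X
    simp only [hs]
    rw [Finset.sum_range_succ', visitMoment_zero, ← Finset.sum_add_distrib, Finset.sum_div,
      Finset.mul_sum, Finset.mul_sum, add_comm, pow_zero, one_mul]
    congr 1
    refine Finset.sum_congr rfl fun N _ => ?_
    rw [visitMoment_succ]
    ring
  have hbound : ∀ n X, |F X - s n X| ≤ l ^ n * C := by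
    intro n
    induction n with
    | zero => intro X; simpa [hs] using hC X
    | succ n ih =>
      intro X
      have hd : F X - s (n + 1) X = (if X = Z then V else 1) * (l *
          (((F (X - 1) - s n (X - 1)) + (F (X + 1) - s n (X + 1))) / 2)) := by
        rw [hF X, hstep]
        ring
      have hv : |if X = Z then V else 1| ≤ 1 := by
        split_ifs
        · rwa [abs_of_nonneg hV0]
        · simp
      have havg : |((F (X - 1) - s n (X - 1)) + (F (X + 1) - s n (X + 1))) / 2| ≤ l ^ n * C := by
        have h1 := abs_le.mp (ih (X - 1))
        have h2 := abs_le.mp (ih (X + 1))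
        rw [abs_le]
        constructor <;> linarith
      rw [hd, abs_mul, abs_mul, abs_of_nonneg hl0]
      calc _ ≤ 1 * (l * (l ^ n * C)) := by gcongr
        _ = l ^ (n + 1) * C := by ring
  rw [hasSum_iff_tendsto_nat_of_nonneg
    fun N => mul_nonneg (pow_nonneg hl0 N) (visitMoment_nonneg hV0 Z N X)]
  have hlim : Tendsto (fun n => l ^ n * C) atTop (nhds 0) := by
    simpa using (tendsto_pow_atTop_nhds_zero_of_lt_one hl0 hl1).mul_const C
  have hdiff : Tendsto (fun n => F X - s n X) atTop (nhds 0) :=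
    squeeze_zero_norm (fun n => hbound n X) hlim
  simpa using tendsto_const_nhds.sub hdiff (a := F X)

theorem pow_natAbs_pred_add_succ (a : ℝ) (ha : a ≠ 0) (Y : ℤ) :
    a ^ (Y - 1).natAbs + a ^ (Y + 1).natAbs =
      if Y = 0 then 2 * a else (a + a⁻¹) * a ^ Y.natAbs := by
  obtain h | rfl | h := lt_trichotomy Y 0
  · obtain ⟨k, rfl⟩ : ∃ k : ℕ, Y = -(k + 1) := ⟨(-Y - 1).toNat, by omega⟩
    rw [if_neg h.ne, show (-(k + 1 : ℤ) - 1).natAbs = k + 2 by omega,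
      show (-(k + 1 : ℤ) + 1).natAbs = k by omega, show (-(k + 1 : ℤ)).natAbs = k + 1 by omega]
    field_simp
    ring
  · norm_num
    ring
  · obtain ⟨k, rfl⟩ : ∃ k : ℕ, Y = k + 1 := ⟨(Y - 1).toNat, by omega⟩
    rw [if_neg h.ne', show ((k + 1 : ℤ) - 1).natAbs = k by omega,
      show ((k + 1 : ℤ) + 1).natAbs = k + 2 by omega, show (k + 1 : ℤ).natAbs = k + 1 by omega]
    field_simp
    ring

theorem alpha_bounds_and_eq {l : ℝ} (hl0 : 0 < l) (hl1 : l < 1) :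
    0 < (1 - √(1 - l ^ 2)) / l ∧ (1 - √(1 - l ^ 2)) / l < 1 ∧
      l * (1 + ((1 - √(1 - l ^ 2)) / l) ^ 2) = 2 * ((1 - √(1 - l ^ 2)) / l) := by
  have hsq : √(1 - l ^ 2) ^ 2 = 1 - l ^ 2 := Real.sq_sqrt (by nlinarith)
  have hs0 : 0 ≤ √(1 - l ^ 2) := Real.sqrt_nonneg _
  set s := √(1 - l ^ 2)
  refine ⟨div_pos (by nlinarith) hl0, (div_lt_one hl0).mpr (by nlinarith), ?_⟩
  field_simp
  linarith

/-- Eq. (3.13): the joint generating function over step number and visit number. -/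
theorem joint_generating_function (l V : ℝ) (hl0 : 0 < l) (hl1 : l < 1)
    (hV0 : 0 ≤ V) (hV1 : V ≤ 1) (Z X : ℤ) (hZ : 1 ≤ Z)
    (α : ℝ) (hα : α = (1 - Real.sqrt (1 - l ^ 2)) / l) :
    HasSum (fun N : ℕ => l ^ N * ∑ K ∈ Finset.range (N + 1), V ^ K * P N X K Z)
      ((1 + α ^ 2) / (1 - α ^ 2)
          * (α ^ X.natAbs - α ^ (Z + |X - Z|).toNat)
        + (1 + α ^ 2) / (1 + α ^ 2 - 2 * α ^ 2 * V) * V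
          * α ^ (Z + |X - Z|).toNat) := by
  obtain ⟨ha0, ha1, hal⟩ := alpha_bounds_and_eq hl0 hl1
  rw [← hα] at ha0 ha1 hal
  have h1 : 0 < 1 - α ^ 2 := by nlinarith
  have h2 : 0 < 1 + α ^ 2 := by positivity
  have h3 : 0 < 1 + α ^ 2 - 2 * α ^ 2 * V := by nlinarith [sq_nonneg α]
  have hl : l = 2 * α / (1 + α ^ 2) := by
    rw [eq_div_iff h2.ne', hal]
  set A := (1 + α ^ 2) / (1 - α ^ 2) with hA
  set B := (1 + α ^ 2) / (1 + α ^ 2 - 2 * α ^ 2 * V) with hB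
  have hexp : ∀ Y : ℤ, (Z + |Y - Z|).toNat = Z.natAbs + (Y - Z).natAbs := by
    intro Y
    rw [Int.abs_eq_natAbs]
    omega
  have hpow : ∀ n : ℕ, |α ^ n| ≤ 1 := fun n => by
    rw [abs_of_nonneg (by positivity)]
    exact pow_le_one₀ ha0.le ha1.le
  simp only [sum_pow_mul_P]
  refine hasSum_of_bounded_solution hl0.le hl1 hV0 hV1 Z
    (fun Y => A * (α ^ Y.natAbs - α ^ (Z + |Y - Z|).toNat) + B * V * α ^ (Z + |Y - Z|).toNat)
    (|A| * (1 + 1) + |B * V| * 1) (fun Y => ?_) (fun Y => ?_) X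
  · refine (abs_add_le _ _).trans ?_
    rw [abs_mul, abs_mul (B * V)]
    gcongr
    · exact (abs_sub _ _).trans (add_le_add (hpow _) (hpow _))
    · exact hpow _
  · have e1 := pow_natAbs_pred_add_succ α ha0.ne' Y
    have e2 := pow_natAbs_pred_add_succ α ha0.ne' (Y - Z)
    rw [sub_right_comm, sub_add_eq_add_sub] at e2
    simp only [hexp, pow_add]
    have hsum : ∀ a b c d e : ℝ, A * (a - e * b) + B * V * (e * b) + (A * (c - e * d) +
        B * V * (e * d)) = A * (a + c) + (B * V - A) * e * (b + d) := fun _ _ _ _ _ => by ring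
    rw [hsum, e1, e2]
    by_cases hY : Y = Z
    · subst hY
      rw [if_neg (by omega : Y ≠ 0), if_neg (by omega : Y ≠ 0), if_pos rfl, if_pos (sub_self Y)]
      simp only [sub_self, Int.natAbs_zero, pow_zero]
      have hB' : B * (1 + α ^ 2 - 2 * α ^ 2 * V) = 1 + α ^ 2 := div_mul_cancel₀ _ h3.ne'
      clear_value B
      rw [hl, hA]
      linear_combination (norm := (field_simp; ring)) V * α ^ Y.natAbs / (1 + α ^ 2) * hB'
    · rw [if_neg hY, if_neg (sub_ne_zero.mpr hY)]
      by_cases h0 : Y = 0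
      · subst h0
        simp only [if_true, Int.natAbs_zero, pow_zero]
        rw [hl, hA, hB]
        field_simp
        ring
      · rw [if_neg h0, if_neg h0, hl, hA, hB]
        field_simp
        ring
end
end

section
/- Diffusion scaling limit of the visit-number marginal (Eq. (5.5), k > 0 part): let k > 0 and z > 0 be reals, and let (K_N), (Z_N) be sequences of integers with K_N ≥ 1, Z_N ≥ 1, and K_N/√N → k, Z_N/√N → z as N → ∞. Then √N · 𝒫_N(K_N | Z_N) → √(2/π) · e^{−(k+z)²/2} as N → ∞, where 𝒫_N(K|Z) is the probability of exactly K visits to Z in the first N steps. -/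
open Finset Filter Real

noncomputable section

/-! ### First-step recursions -/

/-- The increment `±1` encoded by a Boolean. -/
def stepVal (b : Bool) : ℤ := if b then 1 else -1

theorem S_cons_succ {N : ℕ} (b : Bool) (ε : Fin N → Bool) (n : ℕ) :
    S (Fin.cons b ε : Fin (N + 1) → Bool) (n + 1) = stepVal b + S ε n := by
  simp only [S, Finset.sum_filter, Fin.sum_univ_succ, Fin.cons_zero, Fin.cons_succ, Fin.val_zero,
    Fin.val_succ, Nat.add_lt_add_iff_right, Nat.succ_pos, if_true, stepVal]

theorem S_zero {N : ℕ} (ε : Fin N → Bool) : S ε 0 = 0 := by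
  simp [S]

theorem visits_eq_sum (N : ℕ) (Z : ℤ) (ε : Fin N → Bool) :
    visits N Z ε = ∑ n ∈ range N, if S ε (n + 1) = Z then 1 else 0 := by
  rw [visits, Finset.card_filter, Finset.range_eq_Ico, Finset.sum_Ico_add' (c := 1)
    (f := fun n => if S ε n = Z then 1 else 0)]
  rfl

theorem visits_cons {N : ℕ} (Z : ℤ) (b : Bool) (ε : Fin N → Bool) :
    visits (N + 1) Z (Fin.cons b ε : Fin (N + 1) → Bool) =
      visits N (Z - stepVal b) ε + if Z - stepVal b = 0 then 1 else 0 := by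
  have h : ∀ x : ℤ, stepVal b + x = Z ↔ x = Z - stepVal b := fun x => by
    constructor <;> intro h <;> omega
  simp only [visits_eq_sum, S_cons_succ, h, Finset.sum_range_succ', S_zero, eq_comm (a := (0 : ℤ))]

theorem card_filter_cons {N : ℕ} (q : (Fin (N + 1) → Bool) → Prop) [DecidablePred q] :
    ((univ.filter q).card : ℝ) =
      ((univ.filter fun ε : Fin N → Bool => q (Fin.cons true ε)).card : ℝ) +
        ((univ.filter fun ε : Fin N → Bool => q (Fin.cons false ε)).card : ℝ) := by
  rw [← Nat.cast_add]
  congr 1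
  simp only [Finset.card_filter]
  rw [← (Fin.consEquiv fun _ : Fin (N + 1) => Bool).sum_comp, Fintype.sum_prod_type,
    Fintype.sum_bool]
  rfl

theorem p_zero (X : ℤ) : p 0 X = if X = 0 then 1 else 0 := by
  by_cases h : X = 0 <;> simp [p, S, h, eq_comm (a := (0 : ℤ))]

theorem p_succ (N : ℕ) (X : ℤ) : p (N + 1) X = (p N (X - 1) + p N (X + 1)) / 2 := by
  have h : ∀ x : ℤ, (1 + x = X ↔ x = X - 1) ∧ (-1 + x = X ↔ x = X + 1) := fun x => by
    omega
  rw [p, card_filter_cons]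
  simp only [S_cons_succ, stepVal, if_true, Bool.false_eq_true, if_false, h, p]
  field_simp
  ring

theorem Pmarg_zero (K : ℕ) (Z : ℤ) : Pmarg 0 K Z = if K = 0 then 1 else 0 := by
  by_cases h : K = 0 <;> simp [Pmarg, visits, h, eq_comm (a := (0 : ℕ))]

theorem Pmarg_eq_zero_of_lt {N K : ℕ} (h : N < K) (Z : ℤ) : Pmarg N K Z = 0 := by
  have : (univ.filter fun ε : Fin N → Bool => visits N Z ε = K) = ∅ :=
    Finset.filter_eq_empty_iff.2 fun ε _ => ((visits_le N Z ε).trans_lt h).ne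
  simp [Pmarg, this]

theorem card_visits_cons {N : ℕ} (K : ℕ) (Z : ℤ) (b : Bool) :
    ((univ.filter fun ε : Fin N → Bool =>
      visits (N + 1) Z (Fin.cons b ε : Fin (N + 1) → Bool) = K).card : ℝ) / 2 ^ N =
      if Z - stepVal b = 0 then (if K = 0 then 0 else Pmarg N (K - 1) 0)
        else Pmarg N K (Z - stepVal b) := by
  simp only [visits_cons, Pmarg]
  split_ifs with h1 h2
  · simp [h2]
  · have : ∀ x : ℕ, x + 1 = K ↔ x = K - 1 := fun x => by omega
    simp only [this, h1]
  · simp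

theorem Pmarg_succ (N K : ℕ) (Z : ℤ) :
    Pmarg (N + 1) K Z =
      ((if Z - 1 = 0 then (if K = 0 then 0 else Pmarg N (K - 1) 0) else Pmarg N K (Z - 1)) +
        (if Z + 1 = 0 then (if K = 0 then 0 else Pmarg N (K - 1) 0) else Pmarg N K (Z + 1))) / 2 := by
  have h1 := card_visits_cons (N := N) K Z true
  have h2 := card_visits_cons (N := N) K Z false
  simp only [stepVal, if_true, Bool.false_eq_true, if_false, sub_neg_eq_add] at h1 h2
  rw [← h1, ← h2, Pmarg, card_filter_cons]
  field_simp
  ring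

theorem p_neg (N : ℕ) (X : ℤ) : p N (-X) = p N X := by
  induction N generalizing X with
  | zero => simp [p_zero]
  | succ N ih =>
    rw [p_succ, p_succ, ← ih (X - 1), ← ih (X + 1), add_comm]
    congr 3 <;> ring

theorem Pmarg_neg (N K : ℕ) (Z : ℤ) : Pmarg N K (-Z) = Pmarg N K Z := by
  induction N generalizing Z with
  | zero => simp [Pmarg_zero]
  | succ N ih =>
    have e1 : -Z - 1 = -(Z + 1) := by ring
    have e2 : -Z + 1 = -(Z - 1) := by ring
    rw [Pmarg_succ, Pmarg_succ, e1, e2, ih, ih, add_comm]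
    simp only [neg_eq_zero]

theorem Pmarg_succ_zero (N K : ℕ) : Pmarg (N + 1) K 0 = Pmarg N K 1 := by
  rw [Pmarg_succ]
  norm_num [Pmarg_neg N K 1]

theorem Pmarg_succ_one (N K : ℕ) :
    Pmarg (N + 1) (K + 1) 1 = (Pmarg N K 0 + Pmarg N (K + 1) 2) / 2 := by
  rw [Pmarg_succ]
  norm_num

theorem Pmarg_succ_of_two_le (N K : ℕ) {Z : ℤ} (hZ : 2 ≤ Z) :
    Pmarg (N + 1) K Z = (Pmarg N K (Z - 1) + Pmarg N K (Z + 1)) / 2 := by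
  rw [Pmarg_succ, if_neg (by omega), if_neg (by omega)]

/-! ### Exact formulas -/

theorem Pmarg_zero_visits (N Z : ℕ) (hZ : 1 ≤ Z) :
    Pmarg N 0 Z = ∑ r ∈ range Z, (p N r + p N (r + 1)) := by
  induction N generalizing Z with
  | zero =>
    obtain ⟨Z, rfl⟩ := Nat.exists_eq_add_of_le' hZ
    rw [Finset.sum_range_succ', Finset.sum_eq_zero]
    · norm_num [Pmarg_zero, p_zero]
    · intro r _
      rw [p_zero, p_zero, if_neg (by omega), if_neg (by omega), add_zero]
  | succ N ih =>
    have key : ∀ Z : ℕ, 2 * ∑ r ∈ range (Z + 1), (p (N + 1) r + p (N + 1) (r + 1)) =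
        ∑ r ∈ range Z, (p N r + p N (r + 1)) + ∑ r ∈ range (Z + 2), (p N r + p N (r + 1)) := by
      intro Z
      induction Z with
      | zero =>
        have := p_neg N 1
        norm_num [Finset.sum_range_succ, p_succ] at this ⊢
        rw [this]; ring
      | succ Z ih =>
        rw [Finset.sum_range_succ, mul_add, ih, Finset.sum_range_succ _ (Z + 2),
          Finset.sum_range_succ _ Z, p_succ, p_succ]
        push_cast
        have e1 : (Z : ℤ) + 1 - 1 = Z := by ring
        have e2 : (Z : ℤ) + 1 + 1 - 1 = Z + 1 := by ring
        have e3 : (Z : ℤ) + 1 + 1 = Z + 2 := by ring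
        rw [e1, e2, e3]
        ring
    obtain ⟨Z, rfl⟩ := Nat.exists_eq_add_of_le' hZ
    rw [eq_div_of_mul_eq two_ne_zero ((mul_comm _ _).trans (key Z)), Pmarg_succ]
    have h2 := ih (Z + 2) (by omega)
    push_cast at h2 ⊢
    rw [if_neg (c := (Z : ℤ) + 1 + 1 = 0) (by omega), show (Z : ℤ) + 1 + 1 = Z + 2 by ring, h2]
    rcases Nat.eq_zero_or_pos Z with rfl | hZ
    · simp
    · rw [if_neg (by omega), show (Z : ℤ) + 1 - 1 = Z by ring, ih Z hZ]

theorem p_one_of_two_le {X : ℤ} (hX : 2 ≤ X) : p 1 X = 0 := by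
  rw [← zero_add 1, p_succ, p_zero, p_zero, if_neg (by omega), if_neg (by omega)]
  norm_num

theorem p_zero_of_one_le {X : ℤ} (hX : 1 ≤ X) : p 0 X = 0 := by
  rw [p_zero, if_neg (by omega)]

theorem p_succ_add_p_succ (n : ℕ) (X : ℤ) :
    p (n + 2) X + p (n + 1) X =
      ((p (n + 1) (X - 1) + p n (X - 1)) + (p (n + 1) (X + 1) + p n (X + 1))) / 2 := by
  rw [p_succ (n + 1), p_succ n X]
  ring

theorem Pmarg_eq_p_add_p (n K : ℕ) {Z : ℤ} (hZ : 1 ≤ Z) :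
    Pmarg (n + K + 1) (K + 1) Z = p (n + 1) (Z + K) + p n (Z + K) := by
  induction h : n + K using Nat.strong_induction_on generalizing n K Z with
  | _ N ih =>
  subst h
  rcases n with _ | n
  · have hz : ∀ Y, Pmarg (0 + K) (K + 1) Y = 0 := Pmarg_eq_zero_of_lt (by omega)
    rcases hZ.eq_or_lt with rfl | hZ
    · rw [Pmarg_succ_one, hz]
      rcases K with _ | K
      · norm_num [Pmarg_zero, p_succ, p_zero]
      · rw [zero_add, zero_add, Pmarg_succ_zero, Pmarg_eq_zero_of_lt (by omega),
          p_one_of_two_le (by omega), p_zero_of_one_le (by omega)]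
        norm_num
    · rw [Pmarg_succ_of_two_le _ _ hZ, hz, hz, zero_add, p_one_of_two_le (by omega),
        p_zero_of_one_le (by omega)]
      norm_num
  · have hN : n + 1 + K = n + K + 1 := by omega
    have ih' : ∀ Y : ℤ, 1 ≤ Y →
        Pmarg (n + K + 1) (K + 1) Y = p (n + 1) (Y + K) + p n (Y + K) :=
      fun Y hY => ih (n + K) (by omega) n K hY rfl
    rw [p_succ_add_p_succ, hN]
    rcases hZ.eq_or_lt with rfl | hZ
    · rw [Pmarg_succ_one, ih' 2 (by norm_num)]
      have h0 : Pmarg (n + K + 1) K 0 = p (n + 1) K + p n K := by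
        rw [Pmarg_succ_zero]
        rcases K with _ | K
        · have h1 := Pmarg_zero_visits n 1 le_rfl
          have h2 := p_neg n 1
          norm_num [p_succ] at h1 h2 ⊢
          rw [h1, h2]
          ring
        · rw [← add_assoc, ih (n + K) (by omega) n K le_rfl rfl]
          push_cast
          rw [add_comm (K : ℤ)]
      rw [h0, show (1 : ℤ) + K - 1 = K by ring, show (1 : ℤ) + K + 1 = 2 + K by ring]
    · rw [Pmarg_succ_of_two_le _ _ hZ, ih' _ (by omega), ih' _ (by omega)]
      congr 3 <;> ring_nf

theorem p_eq_zero_of_lt (N : ℕ) {X : ℤ} (h : N < |X|) : p N X = 0 := by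
  induction N generalizing X with
  | zero => rw [p_zero, if_neg (by rintro rfl; simp at h)]
  | succ N ih =>
    rw [lt_abs] at h
    push_cast at h
    rw [p_succ, ih (lt_abs.2 (by omega)), ih (lt_abs.2 (by omega))]
    norm_num

theorem p_eq_zero_of_odd (N : ℕ) {X : ℤ} (h : Odd (N + X)) : p N X = 0 := by
  induction N generalizing X with
  | zero => rw [p_zero, if_neg (by rintro rfl; simp at h)]
  | succ N ih =>
    obtain ⟨c, hc⟩ := h
    push_cast at hc
    rw [p_succ, ih ⟨c - 1, by omega⟩, ih ⟨c, by omega⟩]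
    norm_num

theorem p_eq_choose (N j : ℕ) : p N (2 * j - N) = (N.choose j : ℝ) / 2 ^ N := by
  induction N generalizing j with
  | zero =>
    rcases j with _ | j
    · simp [p_zero]
    · rw [p_zero, if_neg (by push_cast; omega)]
      simp
  | succ N ih =>
    have h1 := ih j
    rw [p_succ]
    rcases j with _ | j
    · rw [p_eq_zero_of_lt N (lt_abs.2 (by push_cast; omega)),
        show (2 * ((0 : ℕ) : ℤ) - ((N + 1 : ℕ) : ℤ) + 1) = 2 * ((0 : ℕ) : ℤ) - N by push_cast; ring, h1]
      simp [pow_succ]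
      field_simp
    · rw [show (2 * ((j + 1 : ℕ) : ℤ) - ((N + 1 : ℕ) : ℤ) - 1) = 2 * (j : ℤ) - N by push_cast; ring,
        show (2 * ((j + 1 : ℕ) : ℤ) - ((N + 1 : ℕ) : ℤ) + 1) = 2 * ((j + 1 : ℕ) : ℤ) - N by
          push_cast; ring, h1, ih j, Nat.choose_succ_succ]
      push_cast
      field_simp
      ring

/-! ### A local central limit theorem for binomial coefficients -/

theorem tendsto_mul_log_one_add {α : Type*} {l : Filter α} {a g : α → ℝ} {t : ℝ}
    (hg : Tendsto g l (nhds 0)) (hag : Tendsto (fun x => a x * g x) l (nhds t)) :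
    Tendsto (fun x => a x * Real.log (1 + g x)) l (nhds t) := by
  have hc : ContinuousAt (dslope Real.log 1) 1 :=
    continuousAt_dslope_same.2 (Real.differentiableAt_log one_ne_zero)
  have h1 : Tendsto (fun x => dslope Real.log 1 (1 + g x)) l (nhds 1) := by
    have := hc.tendsto.comp (show Tendsto (fun x => 1 + g x) l (nhds 1) by
      simpa using hg.const_add 1)
    rwa [dslope_same, Real.deriv_log, inv_one] at this
  have h2 := hag.mul h1
  rw [mul_one] at h2
  refine h2.congr fun x => ?_
  have := sub_smul_dslope Real.log 1 (1 + g x)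
  simp only [smul_eq_mul, Real.log_one, sub_zero, add_sub_cancel_left] at this
  rw [mul_assoc, this]

theorem factorial_eq_stirlingSeq_mul {n : ℕ} (hn : n ≠ 0) :
    (n.factorial : ℝ) = Stirling.stirlingSeq n * (√(2 * n) * (n / Real.exp 1) ^ n) := by
  rw [Stirling.stirlingSeq, div_mul_cancel₀]
  positivity

theorem choose_div_two_pow_eq {i j : ℕ} (hi : i ≠ 0) (hj : j ≠ 0) :
    ((i + j).choose i : ℝ) / 2 ^ (i + j) =
      Stirling.stirlingSeq (i + j) / (Stirling.stirlingSeq i * Stirling.stirlingSeq j) *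
        √((i + j) / (2 * i * j)) *
        Real.exp (-(i * Real.log (2 * i / (i + j)) + j * Real.log (2 * j / (i + j)))) := by
  have hi' : (0 : ℝ) < i := by positivity
  have hj' : (0 : ℝ) < j := by positivity
  have hsi : Stirling.stirlingSeq i ≠ 0 := by
    rw [Stirling.stirlingSeq]; positivity
  have hsj : Stirling.stirlingSeq j ≠ 0 := by
    rw [Stirling.stirlingSeq]; positivity
  have hsqrt : √(2 * ((i : ℝ) + j)) = √(2 * i) * √(2 * j) * √((i + j) / (2 * i * j)) := by
    rw [← Real.sqrt_mul (by positivity), ← Real.sqrt_mul (by positivity)]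
    congr 1
    field_simp
  have hexp : Real.exp (-(i * Real.log (2 * i / (i + j)) + j * Real.log (2 * j / (i + j)))) =
      ((i + j : ℝ) / (2 * i)) ^ i * ((i + j : ℝ) / (2 * j)) ^ j := by
    rw [neg_add, Real.exp_add, ← mul_neg, ← mul_neg, ← Real.log_inv, ← Real.log_inv, inv_div,
      inv_div, Real.exp_nat_mul, Real.exp_nat_mul, Real.exp_log (by positivity),
      Real.exp_log (by positivity)]
  rw [Nat.choose_symm_add, Nat.add_choose, Nat.cast_div (Nat.factorial_mul_factorial_dvd_factorial_add i j)
    (by positivity), hexp]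
  push_cast
  rw [factorial_eq_stirlingSeq_mul hi, factorial_eq_stirlingSeq_mul hj,
    factorial_eq_stirlingSeq_mul (n := i + j) (by omega)]
  push_cast
  rw [hsqrt]
  simp only [div_pow, mul_pow, pow_add]
  field_simp

theorem tendsto_sqrt_mul_choose_div_two_pow {i j : ℕ → ℕ} {x : ℝ}
    (hsum : Tendsto (fun N : ℕ => ((i N : ℝ) + j N) / N) atTop (nhds 1))
    (hdiff : Tendsto (fun N : ℕ => ((i N : ℝ) - j N) / √N) atTop (nhds x)) :
    Tendsto (fun N : ℕ => √N * (((i N + j N).choose (i N) : ℝ) / 2 ^ (i N + j N))) atTop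
      (nhds (√(2 / π) * Real.exp (-x ^ 2 / 2))) := by
  have hsN : Tendsto (fun N : ℕ => √(N : ℝ)) atTop atTop :=
    Real.tendsto_sqrt_atTop.comp tendsto_natCast_atTop_atTop
  have hsN' : Tendsto (fun N : ℕ => (√(N : ℝ))⁻¹) atTop (nhds 0) := tendsto_inv_atTop_zero.comp hsN
  have hd0 : Tendsto (fun N : ℕ => ((i N : ℝ) - j N) / N) atTop (nhds 0) := by
    have := hdiff.mul hsN'
    rw [mul_zero] at this
    refine this.congr fun N => ?_
    rw [← div_eq_mul_inv, div_div, Real.mul_self_sqrt (Nat.cast_nonneg N)]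
  have hi : Tendsto (fun N : ℕ => (i N : ℝ) / N) atTop (nhds (1 / 2)) := by
    have := (hsum.add hd0).div_const 2
    rw [add_zero] at this
    exact this.congr fun N => by ring
  have hj : Tendsto (fun N : ℕ => (j N : ℝ) / N) atTop (nhds (1 / 2)) := by
    have := (hsum.sub hd0).div_const 2
    rw [sub_zero] at this
    exact this.congr fun N => by ring
  have atTop_of : ∀ f : ℕ → ℕ, Tendsto (fun N : ℕ => (f N : ℝ) / N) atTop (nhds (1 / 2)) →
      Tendsto f atTop atTop := by
    intro f hf
    rw [← tendsto_natCast_atTop_iff (R := ℝ)]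
    refine (hf.pos_mul_atTop (by norm_num) tendsto_natCast_atTop_atTop).congr' ?_
    filter_upwards [eventually_gt_atTop 0] with N hN
    field_simp
  have hi' := atTop_of i hi
  have hj' := atTop_of j hj
  have hpos : ∀ᶠ N : ℕ in atTop, 0 < N ∧ 0 < i N ∧ 0 < j N :=
    (eventually_gt_atTop 0).and ((hi'.eventually_gt_atTop 0).and (hj'.eventually_gt_atTop 0))
  have hS : Tendsto (fun N => Stirling.stirlingSeq (i N + j N) /
      (Stirling.stirlingSeq (i N) * Stirling.stirlingSeq (j N))) atTop (nhds (√π / (√π * √π))) := by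
    have hst := Stirling.tendsto_stirlingSeq_sqrt_pi
    exact (hst.comp (hi'.atTop_add_nonneg fun N => Nat.zero_le _)).div
      ((hst.comp hi').mul (hst.comp hj')) (by positivity)
  have hR : Tendsto (fun N : ℕ => √N * √(((i N : ℝ) + j N) / (2 * i N * j N))) atTop (nhds √2) := by
    have h := (hsum.div ((hi.const_mul 2).mul hj) (by norm_num)).sqrt
    rw [show (1 : ℝ) / (2 * (1 / 2) * (1 / 2)) = 2 by norm_num] at h
    refine h.congr' ?_
    filter_upwards [hpos] with N hN
    obtain ⟨h1, h2, h3⟩ := hN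
    rw [← Real.sqrt_mul (Nat.cast_nonneg N)]
    congr 1
    simp only [Pi.div_apply]
    field_simp
  set u : ℕ → ℝ := fun N => ((i N : ℝ) - j N) / (i N + j N) with hu_def
  have hsu : Tendsto (fun N : ℕ => √N * u N) atTop (nhds x) := by
    have := hdiff.div hsum one_ne_zero
    rw [div_one] at this
    refine this.congr' ?_
    filter_upwards [hpos] with N hN
    obtain ⟨h1, h2, h3⟩ := hN
    have : (N : ℝ) = √N * √N := (Real.mul_self_sqrt (Nat.cast_nonneg N)).symm
    simp only [hu_def, Pi.div_apply]
    have h4 : 0 < √(N : ℝ) := Real.sqrt_pos.2 (by exact_mod_cast h1)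
    have h5 : (0 : ℝ) < i N + j N := by positivity
    field_simp
    rw [sq, ← this]
  have hu : Tendsto u atTop (nhds 0) := by
    have := hd0.div hsum one_ne_zero
    rw [zero_div] at this
    refine this.congr' ?_
    filter_upwards [hpos] with N hN
    obtain ⟨h1, h2, h3⟩ := hN
    simp only [hu_def, Pi.div_apply]
    field_simp
  have hlog1 : Tendsto (fun N : ℕ => √N * Real.log (1 + u N)) atTop (nhds x) :=
    tendsto_mul_log_one_add hu hsu
  have hlog2 : Tendsto (fun N : ℕ => √N * Real.log (1 + -u N)) atTop (nhds (-x)) :=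
    tendsto_mul_log_one_add (by simpa using hu.neg) (by simpa using hsu.neg)
  have hlog3 : Tendsto (fun N : ℕ => (N : ℝ) * Real.log (1 + -(u N * u N))) atTop
      (nhds (-(x * x))) := by
    refine tendsto_mul_log_one_add (by simpa using (hu.mul hu).neg) ?_
    refine (hsu.mul hsu).neg.congr fun N => ?_
    rw [mul_mul_mul_comm, Real.mul_self_sqrt (Nat.cast_nonneg N)]
    ring
  have hE : Tendsto (fun N : ℕ => (i N : ℝ) * Real.log (2 * i N / (i N + j N)) +
      j N * Real.log (2 * j N / (i N + j N))) atTop (nhds (x ^ 2 / 2)) := by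
    have h := ((hsum.mul hlog3).add (hdiff.mul (hlog1.sub hlog2))).div_const 2
    rw [show (1 * -(x * x) + x * (x - -x)) / 2 = x ^ 2 / 2 by ring] at h
    refine h.congr' ?_
    filter_upwards [hpos] with N hN
    obtain ⟨h1, h2, h3⟩ := hN
    have h4 : 0 < √(N : ℝ) := Real.sqrt_pos.2 (by exact_mod_cast h1)
    have h5 : (0 : ℝ) < i N + j N := by positivity
    have e1 : 1 + u N = 2 * i N / (i N + j N) := by simp only [hu_def]; field_simp; ring
    have e2 : 1 + -u N = 2 * j N / (i N + j N) := by simp only [hu_def]; field_simp; ring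
    have e3 : 1 + -(u N * u N) = (1 + u N) * (1 + -u N) := by ring
    rw [e3, e1, e2, Real.log_mul (by positivity) (by positivity)]
    field_simp
    ring
  have hfinal := (hS.mul hR).mul ((Real.continuous_exp.tendsto _).comp hE.neg)
  rw [show √π / (√π * √π) * √2 = √(2 / π) by
    rw [Real.sqrt_div zero_le_two]; field_simp, ← neg_div] at hfinal
  refine hfinal.congr' ?_
  filter_upwards [hpos] with N hN
  rw [choose_div_two_pow_eq hN.2.1.ne' hN.2.2.ne']
  simp only [Function.comp_apply]
  ring

theorem exists_Pmarg_eq_choose {N K : ℕ} {Z : ℤ} (hK : 1 ≤ K) (hZ : 1 ≤ Z)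
    (hN : 2 * K + Z ≤ N) :
    ∃ i j δ : ℕ, δ ≤ 1 ∧ i + j + K = N + δ ∧ (i : ℤ) - j = Z + K - 1 ∧
      Pmarg N K Z = ((i + j).choose i : ℝ) / 2 ^ (i + j) := by
  obtain ⟨K, rfl⟩ := Nat.exists_eq_add_of_le' hK
  obtain ⟨n, rfl⟩ : ∃ n, N = n + K + 1 := ⟨N - K - 1, by omega⟩
  obtain ⟨a, ha⟩ : ∃ a : ℕ, (a : ℤ) = Z + K := ⟨(Z + K).toNat, by omega⟩
  have choose_eq : ∀ i j : ℕ, (i : ℤ) - j = Z + K →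
      p (i + j) (Z + K) = ((i + j).choose i : ℝ) / 2 ^ (i + j) := by
    intro i j h
    rw [← p_eq_choose, ← h]
    congr 1
    push_cast
    ring
  rw [Pmarg_eq_p_add_p n K hZ]
  rcases Nat.even_or_odd' (n + a) with ⟨c, hc | hc⟩
  · refine ⟨c, n - c, 0, by omega, by omega, by omega, ?_⟩
    rw [p_eq_zero_of_odd (n + 1) ⟨c, by push_cast; omega⟩, zero_add,
      ← choose_eq c (n - c) (by omega), show c + (n - c) = n by omega]
  · refine ⟨c + 1, n - c, 1, by omega, by omega, by omega, ?_⟩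
    rw [p_eq_zero_of_odd n ⟨c, by omega⟩, add_zero,
      ← choose_eq (c + 1) (n - c) (by omega), show c + 1 + (n - c) = n + 1 by omega]

/-- Eq. (5.5), `k > 0` part: diffusion scaling limit of the visit-number marginal. -/
theorem K_marginal_scaling_limit (k z : ℝ) (hk : 0 < k) (hz : 0 < z)
    (K : ℕ → ℕ) (Z : ℕ → ℤ)
    (hK1 : ∀ N, 1 ≤ K N) (hZ1 : ∀ N, 1 ≤ Z N)
    (hk' : Tendsto (fun N : ℕ => (K N : ℝ) / Real.sqrt N) atTop (nhds k))
    (hz' : Tendsto (fun N : ℕ => (Z N : ℝ) / Real.sqrt N) atTop (nhds z)) :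
    Tendsto (fun N : ℕ => Real.sqrt N * Pmarg N (K N) (Z N)) atTop
      (nhds (Real.sqrt (2 / Real.pi) * Real.exp (-(k + z) ^ 2 / 2))) := by
  have hsN' : Tendsto (fun N : ℕ => (√(N : ℝ))⁻¹) atTop (nhds 0) :=
    tendsto_inv_atTop_zero.comp (Real.tendsto_sqrt_atTop.comp tendsto_natCast_atTop_atTop)
  have div_tendsto_zero : ∀ {f : ℕ → ℝ} {y : ℝ}, Tendsto (fun N : ℕ => f N / √N) atTop (nhds y) →
      Tendsto (fun N : ℕ => f N / N) atTop (nhds 0) := by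
    intro f y hf
    have := hf.mul hsN'
    rw [mul_zero] at this
    refine this.congr fun N => ?_
    rw [← div_eq_mul_inv, div_div, Real.mul_self_sqrt (Nat.cast_nonneg N)]
  have hK0 := div_tendsto_zero hk'
  have hZ0 := div_tendsto_zero hz'
  have hlarge : ∀ᶠ N : ℕ in atTop, 2 * (K N : ℤ) + Z N ≤ N := by
    have h := (hK0.const_mul 2).add hZ0
    rw [mul_zero, add_zero] at h
    filter_upwards [h.eventually_lt_const one_pos, eventually_gt_atTop 0] with N h1 h2
    have h3 : (0 : ℝ) < N := by exact_mod_cast h2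
    rw [← mul_div_assoc, ← add_div, div_lt_one h3] at h1
    exact_mod_cast h1.le
  have hex : ∀ N : ℕ, ∃ i j δ : ℕ, 2 * (K N : ℤ) + Z N ≤ N →
      δ ≤ 1 ∧ i + j + K N = N + δ ∧ (i : ℤ) - j = Z N + K N - 1 ∧
      Pmarg N (K N) (Z N) = ((i + j).choose i : ℝ) / 2 ^ (i + j) := by
    intro N
    by_cases h : 2 * (K N : ℤ) + Z N ≤ N
    · obtain ⟨i, j, δ, hij⟩ := exists_Pmarg_eq_choose (hK1 N) (hZ1 N) h
      exact ⟨i, j, δ, fun _ => hij⟩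
    · exact ⟨0, 0, 0, fun h' => absurd h' h⟩
  choose i j δ hij using hex
  have hδ : Tendsto (fun N : ℕ => (δ N : ℝ) / N) atTop (nhds 0) := by
    refine squeeze_zero' (.of_forall fun N => by positivity) ?_ tendsto_one_div_atTop_nhds_zero_nat
    filter_upwards [hlarge] with N hN
    have : (δ N : ℝ) ≤ 1 := by exact_mod_cast (hij N hN).1
    gcongr
  have hsum : Tendsto (fun N : ℕ => ((i N : ℝ) + j N) / N) atTop (nhds 1) := by
    have h := (hδ.sub hK0).const_add 1
    rw [sub_zero, add_zero] at h
    refine h.congr' ?_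
    filter_upwards [hlarge, eventually_gt_atTop 0] with N hN hN0
    have : (i N : ℝ) + j N + K N = N + δ N := by exact_mod_cast (hij N hN).2.1
    field_simp
    linarith
  have hdiff : Tendsto (fun N : ℕ => ((i N : ℝ) - j N) / √N) atTop (nhds (k + z)) := by
    have h := (hk'.add hz').sub hsN'
    rw [sub_zero] at h
    refine h.congr' ?_
    filter_upwards [hlarge] with N hN
    have : (i N : ℝ) - j N = Z N + K N - 1 := by exact_mod_cast (hij N hN).2.2.1
    rw [this]
    ring
  refine (tendsto_sqrt_mul_choose_div_two_pow hsum hdiff).congr' ?_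
  filter_upwards [hlarge] with N hN
  rw [(hij N hN).2.2.2]
end
end
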